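/- There exist finite connected simple graphs G and G′ with the same number of vertices and the same number of edges such that T_G = T_{G′} as polynomials, the Jacobians Jac(G) and Jac(G′) are isomorphic as abelian groups, and yet G and G′ do not have the same two-variable zeta function; that is, there exist integers d and r such that the number of divisor classes of degree d and Baker–Norine rank r on G differs from that number on G′. -/

import Mathlib

open scoped Classical

namespace BNGraph

variable {V : Type} [Fintype V]

/-- The degree of a divisor `D : V → ℤ`: the sum of its values. -/
def degSum (D : V → ℤ) : ℤ := ∑ v, D v

/-- A divisor is effective if all its values are nonnegative. -/
def Effective (D : V → ℤ) : Prop := ∀ v, 0 ≤ D v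

/-- The combinatorial Laplacian of a graph, as a homomorphism on divisors. -/
noncomputable def lap (G : SimpleGraph V) : (V → ℤ) →+ (V → ℤ) where
  toFun f := fun v => (G.degree v : ℤ) * f v - ∑ w ∈ G.neighborFinset v, f w
  map_zero' := by
    funext v; simp
  map_add' f g := by
    funext v
    simp only [Pi.add_apply, Finset.sum_add_distrib]
    ring

/-- The subgroup of principal divisors: the image of the Laplacian. -/
noncomputable def Principal (G : SimpleGraph V) : AddSubgroup (V → ℤ) := (lap G).range

/-- Linear equivalence of divisors. -/
def LinEquiv (G : SimpleGraph V) (D D' : V → ℤ) : Prop := D - D' ∈ Principal G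

/-- A divisor is winnable if it is linearly equivalent to an effective divisor. -/
def Winnable (G : SimpleGraph V) (D : V → ℤ) : Prop :=
  ∃ E : V → ℤ, Effective E ∧ LinEquiv G D E

/-- The Baker–Norine rank of a divisor: the largest `r ≥ 0` such that `D - E` is
winnable for every effective divisor `E` of degree `r`, or `-1` if there is no such `r`
(equivalently, if `D` itself is not winnable). -/
noncomputable def bnRank (G : SimpleGraph V) (D : V → ℤ) : ℤ :=
  sSup {r : ℤ | r = -1 ∨ (0 ≤ r ∧
    ∀ E : V → ℤ, Effective E → degSum E = r → Winnable G (D - E))}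

/-- The Picard group of a graph: divisors modulo principal divisors. -/
abbrev Pic (G : SimpleGraph V) : Type _ := (V → ℤ) ⧸ Principal G

/-- The number of divisor classes of degree `d` and Baker–Norine rank `r`. -/
noncomputable def numClasses (G : SimpleGraph V) (d r : ℤ) : ℕ :=
  Set.ncard {c : Pic G | ∃ D : V → ℤ,
    QuotientAddGroup.mk' (Principal G) D = c ∧ degSum D = d ∧ bnRank G D = r}

/-- Two graphs have the same two-variable zeta function iff for every degree `d` and
rank `r` they have the same number of divisor classes of degree `d` and rank `r`. -/
def SameZeta {W : Type} [Fintype W] (G : SimpleGraph V) (G' : SimpleGraph W) : Prop :=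
  ∀ d r : ℤ, numClasses G d r = numClasses G' d r

/-- Degree as a homomorphism on divisors. -/
def degHom : (V → ℤ) →+ ℤ where
  toFun := degSum
  map_zero' := by simp [degSum]
  map_add' f g := by simp [degSum, Finset.sum_add_distrib]

/-- The subgroup of divisors of degree zero. -/
def Deg0 (V : Type) [Fintype V] : AddSubgroup (V → ℤ) := (degHom (V := V)).ker

/-- The Jacobian of a graph: divisor classes of degree zero. -/
noncomputable abbrev Jac (G : SimpleGraph V) : Type _ :=
  Deg0 V ⧸ ((Principal G).addSubgroupOf (Deg0 V))

/-- The number of connected components of the spanning subgraph with edge set `A`. -/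
noncomputable def numComponents (V : Type) [Fintype V] (A : Set (Sym2 V)) : ℕ :=
  Nat.card (SimpleGraph.fromEdgeSet A).ConnectedComponent

/-- The number of edges of a graph. -/
noncomputable def edgeCount (G : SimpleGraph V) : ℕ := Nat.card G.edgeSet

open MvPolynomial in
/-- The Tutte polynomial of `G`, as a polynomial in `ℤ[x, y]` with `x = X 0`, `y = X 1`:
`T_G(x,y) = Σ_{A ⊆ E(G)} (x−1)^(c(A)−c(E(G))) (y−1)^(c(A)+|A|−|V(G)|)`. -/
noncomputable def tutte (G : SimpleGraph V) : MvPolynomial (Fin 2) ℤ :=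
  ∑ A ∈ G.edgeFinset.powerset,
    (X 0 - 1) ^ (numComponents V ↑A - numComponents V G.edgeSet) *
    (X 1 - 1) ^ (numComponents V ↑A + A.card - Fintype.card V)


/-! ### Graphs on six vertices given by a list of eight edges -/

/-- The `i`-th edge. -/
def edg (E : Fin 8 → Fin 6 × Fin 6) (i : Fin 8) : Sym2 (Fin 6) := s((E i).1, (E i).2)

/-- The graph with the given edges. -/
def mkG (E : Fin 8 → Fin 6 × Fin 6) : SimpleGraph (Fin 6) :=
  SimpleGraph.fromEdgeSet (Set.range (edg E))

/-- Component labels of the spanning subgraph with a given list of edges. -/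
def lab : List (Fin 6 × Fin 6) → Fin 6 → Fin 6
  | [], v => v
  | e :: l, v => if lab l v = lab l e.2 then lab l e.1 else lab l v

theorem lab_edge (l : List (Fin 6 × Fin 6)) : ∀ e ∈ l, lab l e.1 = lab l e.2 := by
  induction l with
  | nil => simp
  | cons a l ih =>
    intro e he
    rcases List.mem_cons.1 he with rfl | he
    · simp [lab]
    · simp [lab, ih e he]

theorem lab_reach (H : SimpleGraph (Fin 6)) (l : List (Fin 6 × Fin 6))
    (h : ∀ e ∈ l, H.Reachable e.1 e.2) : ∀ u v, lab l u = lab l v → H.Reachable u v := by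
  induction l with
  | nil => intro u v huv; simp only [lab] at huv; subst huv; exact SimpleGraph.Reachable.refl _
  | cons a l ih =>
    have ih' := ih (fun e he => h e (List.mem_cons_of_mem _ he))
    have ha := h a List.mem_cons_self
    intro u v huv
    simp only [lab] at huv
    split_ifs at huv with h1 h2 h2
    · exact ih' _ _ (h1.trans h2.symm)
    · exact (ih' _ _ h1).trans (ha.symm.trans (ih' _ _ huv))
    · exact (ih' _ _ huv).trans (ha.trans (ih' _ _ h2).symm)
    · exact ih' _ _ huv

theorem lab_iff (H : SimpleGraph (Fin 6)) (l : List (Fin 6 × Fin 6))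
    (h : ∀ e ∈ l, H.Reachable e.1 e.2)
    (h' : ∀ u v, H.Adj u v → (u, v) ∈ l ∨ (v, u) ∈ l) (u v : Fin 6) :
    H.Reachable u v ↔ lab l u = lab l v := by
  refine ⟨?_, lab_reach H l h u v⟩
  rintro ⟨p⟩
  induction p with
  | nil => rfl
  | cons hadj p ih =>
    refine Eq.trans ?_ ih
    rcases h' _ _ hadj with h1 | h1
    · exact lab_edge l _ h1
    · exact (lab_edge l _ h1).symm

/-- Number of labels. -/
def cnt (l : List (Fin 6 × Fin 6)) : ℕ := (Finset.univ.image (lab l)).card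

theorem card_cc (H : SimpleGraph (Fin 6)) (l : List (Fin 6 × Fin 6))
    (h : ∀ u v, H.Reachable u v ↔ lab l u = lab l v) :
    Nat.card H.ConnectedComponent = cnt l := by
  have e : H.ConnectedComponent ≃ Set.range (lab l) := by
    refine Equiv.ofBijective
      (fun c => ⟨Quot.lift (lab l) (fun a b hab => (h a b).1 hab) c, ?_⟩) ⟨?_, ?_⟩
    · induction c using Quot.ind with
      | mk a => exact ⟨a, rfl⟩
    · intro c d
      induction c using Quot.ind with
      | mk a =>
      induction d using Quot.ind with
      | mk b =>
      intro hab
      exact Quot.sound ((h a b).2 (congrArg Subtype.val hab))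
    · rintro ⟨_, a, rfl⟩
      exact ⟨Quot.mk _ a, rfl⟩
  rw [Nat.card_congr e, cnt, ← Set.ncard_coe_finset, Finset.coe_image, Finset.coe_univ,
    Set.image_univ]
  rfl

/-- The list of edges with index in `S`. -/
def lst (E : Fin 8 → Fin 6 × Fin 6) (b : Fin 8 → Bool) : List (Fin 6 × Fin 6) :=
  ((List.finRange 8).filter b).map E

theorem lab_iff_image (E : Fin 8 → Fin 6 × Fin 6) (S : Set (Fin 8)) (u v : Fin 6) :
    (SimpleGraph.fromEdgeSet (edg E '' S)).Reachable u v ↔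
      lab (lst E (fun i => decide (i ∈ S))) u = lab (lst E (fun i => decide (i ∈ S))) v := by
  apply lab_iff
  · intro e he
    simp only [lst, List.mem_map, List.mem_filter, List.mem_finRange, true_and,
      decide_eq_true_eq] at he
    obtain ⟨i, hi, rfl⟩ := he
    by_cases hne : (E i).1 = (E i).2
    · rw [hne]
    · apply SimpleGraph.Adj.reachable
      rw [SimpleGraph.fromEdgeSet_adj]
      exact ⟨⟨i, hi, rfl⟩, hne⟩
  · intro a b hab
    rw [SimpleGraph.fromEdgeSet_adj] at hab
    obtain ⟨⟨i, hi, hi2⟩, -⟩ := hab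
    have hm : E i ∈ lst E (fun i => decide (i ∈ S)) := by
      simp only [lst, List.mem_map, List.mem_filter, List.mem_finRange, true_and,
        decide_eq_true_eq]
      exact ⟨i, hi, rfl⟩
    rw [edg, Sym2.eq_iff] at hi2
    rcases hi2 with ⟨rfl, rfl⟩ | ⟨rfl, rfl⟩
    · left; exact hm
    · right; exact hm

theorem numComponents_image (E : Fin 8 → Fin 6 × Fin 6) (S : Set (Fin 8)) :
    numComponents (Fin 6) (edg E '' S) = cnt (lst E (fun i => decide (i ∈ S))) :=
  card_cc _ _ (lab_iff_image E S)

theorem edgeSet_mkG (E : Fin 8 → Fin 6 × Fin 6) (hE : ∀ i, (E i).1 ≠ (E i).2) :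
    (mkG E).edgeSet = Set.range (edg E) := by
  rw [mkG, SimpleGraph.edgeSet_fromEdgeSet, sdiff_eq_left, Set.disjoint_left]
  rintro _ ⟨i, rfl⟩ h
  exact hE i (by simpa [edg] using h)

theorem tutte_mkG (E : Fin 8 → Fin 6 × Fin 6) (hE : ∀ i, (E i).1 ≠ (E i).2)
    (hinj : Function.Injective (edg E)) :
    tutte (mkG E) = ∑ S : Finset (Fin 8),
      (MvPolynomial.X 0 - 1) ^ (numComponents (Fin 6) (edg E '' (S : Set (Fin 8))) -
        numComponents (Fin 6) (edg E '' Set.univ)) *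
      (MvPolynomial.X 1 - 1) ^ (numComponents (Fin 6) (edg E '' (S : Set (Fin 8))) +
        S.card - Fintype.card (Fin 6)) := by
  have hf : (mkG E).edgeFinset = Finset.univ.map ⟨edg E, hinj⟩ := by
    ext x
    rw [SimpleGraph.mem_edgeFinset, edgeSet_mkG E hE]
    simp
  unfold tutte
  rw [hf, edgeSet_mkG E hE, Set.image_univ]
  symm
  refine Finset.sum_bij (fun S _ => S.map ⟨edg E, hinj⟩) ?_ ?_ ?_ ?_
  · intro S _
    rw [Finset.mem_powerset]
    exact Finset.map_subset_map.2 (Finset.subset_univ _)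
  · intro S _ T _ h
    exact Finset.map_injective _ h
  · intro A hA
    rw [Finset.mem_powerset, Finset.subset_map_iff] at hA
    obtain ⟨S, -, rfl⟩ := hA
    exact ⟨S, Finset.mem_univ _, rfl⟩
  · intro S _
    simp only [Finset.coe_map, Finset.card_map, Function.Embedding.coeFn_mk]

/-- Diamond with a triangle attached at a vertex of degree two. -/
def E1 : Fin 8 → Fin 6 × Fin 6 :=
  ![(0, 1), (0, 2), (1, 2), (0, 3), (1, 3), (2, 4), (2, 5), (4, 5)]

/-- Diamond with a triangle attached at a vertex of degree three. -/
def E2 : Fin 8 → Fin 6 × Fin 6 :=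
  ![(0, 1), (0, 2), (1, 2), (0, 3), (1, 3), (0, 4), (0, 5), (4, 5)]

theorem E1_ne : ∀ i, (E1 i).1 ≠ (E1 i).2 := by decide
theorem E2_ne : ∀ i, (E2 i).1 ≠ (E2 i).2 := by decide
theorem E1_inj : Function.Injective (edg E1) := by
  have : ∀ i j, edg E1 i = edg E1 j → i = j := by decide +kernel
  exact fun i j => this i j
theorem E2_inj : Function.Injective (edg E2) := by
  have : ∀ i j, edg E2 i = edg E2 j → i = j := by decide +kernel
  exact fun i j => this i j

theorem cnt_eq_bool : ∀ b0 b1 b2 b3 b4 b5 b6 b7 : Bool,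
    cnt (lst E1 ![b0, b1, b2, b3, b4, b5, b6, b7]) =
      cnt (lst E2 ![b0, b1, b2, b3, b4, b5, b6, b7]) := by
  decide +kernel

theorem cnt_eq (b : Fin 8 → Bool) : cnt (lst E1 b) = cnt (lst E2 b) := by
  have h : b = ![b 0, b 1, b 2, b 3, b 4, b 5, b 6, b 7] := by
    funext i; fin_cases i <;> rfl
  rw [h]
  exact cnt_eq_bool _ _ _ _ _ _ _ _

theorem tutte_eq : tutte (mkG E1) = tutte (mkG E2) := by
  rw [tutte_mkG E1 E1_ne E1_inj, tutte_mkG E2 E2_ne E2_inj]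
  have h : ∀ S : Set (Fin 8), numComponents (Fin 6) (edg E1 '' S) =
      numComponents (Fin 6) (edg E2 '' S) := by
    intro S
    rw [numComponents_image, numComponents_image, cnt_eq]
  simp only [h]

theorem connected_mkG (E : Fin 8 → Fin 6 × Fin 6)
    (h : ∀ u v, lab (lst E fun _ => true) u = lab (lst E fun _ => true) v) :
    (mkG E).Connected := by
  have : (mkG E).Preconnected := by
    intro u v
    rw [mkG, ← Set.image_univ, lab_iff_image]
    simpa using h u v
  exact ⟨this⟩

theorem conn1 : (mkG E1).Connected := connected_mkG E1 (by decide +kernel)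
theorem conn2 : (mkG E2).Connected := connected_mkG E2 (by decide +kernel)

theorem edgeCount_mkG (E : Fin 8 → Fin 6 × Fin 6) (hE : ∀ i, (E i).1 ≠ (E i).2)
    (hinj : Function.Injective (edg E)) : edgeCount (mkG E) = 8 := by
  rw [edgeCount, edgeSet_mkG E hE, Nat.card_range_of_injective hinj]
  simp

/-! ### Laplacians -/

theorem lap_apply (G : SimpleGraph (Fin 6)) (f : Fin 6 → ℤ) (v : Fin 6) :
    lap G f v = ∑ w, if G.Adj v w then f v - f w else 0 := by
  change (G.degree v : ℤ) * f v - ∑ w ∈ G.neighborFinset v, f w = _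
  rw [← Finset.sum_filter, Finset.sum_sub_distrib, Finset.sum_const, nsmul_eq_mul,
    ← SimpleGraph.neighborFinset_eq_filter, SimpleGraph.card_neighborFinset_eq_degree]

/-- Boolean adjacency. -/
def adjB (E : Fin 8 → Fin 6 × Fin 6) (u v : Fin 6) : Bool :=
  decide (∃ i, E i = (u, v) ∨ E i = (v, u))

theorem adj_mkG (E : Fin 8 → Fin 6 × Fin 6) (hE : ∀ i, (E i).1 ≠ (E i).2) (u v : Fin 6) :
    (mkG E).Adj u v ↔ adjB E u v = true := by
  rw [← SimpleGraph.mem_edgeSet, edgeSet_mkG E hE, adjB, decide_eq_true_eq]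
  simp only [Set.mem_range, edg, Sym2.eq_iff, Prod.ext_iff]

theorem lap_mkG (E : Fin 8 → Fin 6 × Fin 6) (hE : ∀ i, (E i).1 ≠ (E i).2)
    (f : Fin 6 → ℤ) (v : Fin 6) :
    lap (mkG E) f v = ∑ w, if adjB E v w = true then f v - f w else 0 := by
  rw [lap_apply]
  refine Finset.sum_congr rfl fun w _ => ?_
  by_cases h : adjB E v w = true
  · rw [if_pos h, if_pos ((adj_mkG E hE v w).2 h)]
  · rw [if_neg h, if_neg (fun h' => h ((adj_mkG E hE v w).1 h'))]

theorem adjB1 : adjB E1 = fun u v => (![![false, true, true, true, false, false],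
    ![true, false, true, true, false, false],
    ![true, true, false, false, true, true],
    ![true, true, false, false, false, false],
    ![false, false, true, false, false, true],
    ![false, false, true, false, true, false]] u v : Bool) := by
  funext u v; revert u v; decide +kernel

theorem adjB2 : adjB E2 = fun u v => (![![false, true, true, true, true, true],
    ![true, false, true, true, false, false],
    ![true, true, false, false, false, false],
    ![true, true, false, false, false, false],
    ![true, false, false, false, false, true],
    ![true, false, false, false, true, false]] u v : Bool) := by
  funext u v; revert u v; decide +kernel

theorem lap1 (f : Fin 6 → ℤ) : lap (mkG E1) f =
    ![3 * f 0 - f 1 - f 2 - f 3, 3 * f 1 - f 0 - f 2 - f 3,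
      4 * f 2 - f 0 - f 1 - f 4 - f 5, 2 * f 3 - f 0 - f 1,
      2 * f 4 - f 2 - f 5, 2 * f 5 - f 2 - f 4] := by
  funext v
  rw [lap_mkG E1 E1_ne, adjB1]
  fin_cases v <;> simp [Fin.sum_univ_six] <;> ring

theorem lap2 (f : Fin 6 → ℤ) : lap (mkG E2) f =
    ![5 * f 0 - f 1 - f 2 - f 3 - f 4 - f 5, 3 * f 1 - f 0 - f 2 - f 3,
      2 * f 2 - f 0 - f 1, 2 * f 3 - f 0 - f 1,
      2 * f 4 - f 0 - f 5, 2 * f 5 - f 0 - f 4] := by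
  funext v
  rw [lap_mkG E2 E2_ne, adjB2]
  fin_cases v <;> simp [Fin.sum_univ_six] <;> ring

/-- The homomorphism to `ℤ/24` with given weights. -/
def phi (c : Fin 6 → ℤ) : (Fin 6 → ℤ) →+ ZMod 24 where
  toFun D := ((∑ v, c v * D v : ℤ) : ZMod 24)
  map_zero' := by simp
  map_add' f g := by simp [mul_add, Finset.sum_add_distrib]

theorem phi_eq_zero (c D : Fin 6 → ℤ) : phi c D = 0 ↔ (24 : ℤ) ∣ ∑ v, c v * D v := by
  change ((∑ v, c v * D v : ℤ) : ZMod 24) = 0 ↔ _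
  rw [ZMod.intCast_zmod_eq_zero_iff_dvd]
  rfl

def c1 : Fin 6 → ℤ := ![3, -3, 0, 12, 8, 16]
def c2 : Fin 6 → ℤ := ![0, -6, -3, 9, 8, 16]

theorem principal1 (D : Fin 6 → ℤ) :
    D ∈ Principal (mkG E1) ↔ degSum D = 0 ∧ phi c1 D = 0 := by
  rw [phi_eq_zero]
  simp only [degSum, Fin.sum_univ_six, c1]
  constructor
  · rintro ⟨f, rfl⟩
    rw [lap1]
    simp
    constructor
    · ring
    · omega
  · rintro ⟨h0, h1⟩
    simp at h1
    refine ⟨![(D 0 + D 1 + D 3 + (D 0 - D 1) / 4) / 2, (D 0 + D 1 + D 3 - (D 0 - D 1) / 4) / 2,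
      0, (D 0 + D 1 + 2 * D 3) / 2, (2 * D 4 + D 5) / 3, (D 4 + 2 * D 5) / 3], ?_⟩
    rw [lap1]
    funext v
    fin_cases v <;> simp <;> omega

theorem principal2 (D : Fin 6 → ℤ) :
    D ∈ Principal (mkG E2) ↔ degSum D = 0 ∧ phi c2 D = 0 := by
  rw [phi_eq_zero]
  simp only [degSum, Fin.sum_univ_six, c2]
  constructor
  · rintro ⟨f, rfl⟩
    rw [lap2]
    simp
    constructor
    · ring
    · omega
  · rintro ⟨h0, h1⟩
    simp at h1
    refine ⟨![0, (2 * D 1 + D 2 + D 3) / 4, ((2 * D 1 + D 2 + D 3) / 4 + D 2) / 2,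
      ((2 * D 1 + D 2 + D 3) / 4 + D 3) / 2, (2 * D 4 + D 5) / 3, (D 4 + 2 * D 5) / 3], ?_⟩
    rw [lap2]
    funext v
    fin_cases v <;> simp <;> omega

theorem jac_equiv (G : SimpleGraph (Fin 6)) (c : Fin 6 → ℤ)
    (hG : ∀ D, D ∈ Principal G ↔ degSum D = 0 ∧ phi c D = 0)
    (D1 : Fin 6 → ℤ) (h0 : degSum D1 = 0) (h1 : phi c D1 = 1) :
    Nonempty (Jac G ≃+ ZMod 24) := by
  let ψ : Deg0 (Fin 6) →+ ZMod 24 := (phi c).comp (Deg0 (Fin 6)).subtype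
  have hk : (Principal G).addSubgroupOf (Deg0 (Fin 6)) = ψ.ker := by
    ext ⟨D, hD⟩
    rw [AddSubgroup.mem_addSubgroupOf, AddMonoidHom.mem_ker]
    change D ∈ Principal G ↔ phi c D = 0
    rw [hG]
    have hD' : degSum D = 0 := hD
    simp [hD']
  have hs : Function.Surjective ψ := by
    intro z
    refine ⟨(z.val : ℤ) • ⟨D1, h0⟩, ?_⟩
    rw [map_zsmul]
    change (z.val : ℤ) • phi c D1 = z
    rw [h1]
    simp
  exact ⟨(QuotientAddGroup.quotientAddEquivOfEq hk).trans
    (QuotientAddGroup.quotientKerEquivOfSurjective ψ hs)⟩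

theorem jac_iso : Nonempty (Jac (mkG E1) ≃+ Jac (mkG E2)) := by
  obtain ⟨e1⟩ := jac_equiv (mkG E1) c1 principal1 ![3, 0, -2, 0, -1, 0]
    (by decide +kernel) (by decide +kernel)
  obtain ⟨e2⟩ := jac_equiv (mkG E2) c2 principal2 ![0, 0, 0, 1, -1, 0]
    (by decide +kernel) (by decide +kernel)
  exact ⟨e1.trans e2.symm⟩

/-! ### Ranks -/

theorem degSum_sub (D E : Fin 6 → ℤ) : degSum (D - E) = degSum D - degSum E := by
  simp [degSum, Finset.sum_sub_distrib]

theorem degSum_add (D E : Fin 6 → ℤ) : degSum (D + E) = degSum D + degSum E := by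
  simp [degSum, Finset.sum_add_distrib]

theorem degSum_single (v : Fin 6) (a : ℤ) : degSum (Pi.single v a) = a := by
  simp [degSum]

theorem effective_single (v : Fin 6) (a : ℤ) (ha : 0 ≤ a) :
    Effective (Pi.single v a : Fin 6 → ℤ) := by
  intro w
  by_cases h : w = v
  · subst h; simpa using ha
  · simp [h]

theorem phi_single (c : Fin 6 → ℤ) (v : Fin 6) (a : ℤ) :
    phi c (Pi.single v a) = ((c v * a : ℤ) : ZMod 24) := by
  change ((∑ w, c w * (Pi.single v a : Fin 6 → ℤ) w : ℤ) : ZMod 24) = _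
  rw [Finset.sum_eq_single v] <;> simp +contextual [Pi.single_apply]

theorem eff_zero (E : Fin 6 → ℤ) (hE : Effective E) (h : degSum E = 0) : E = 0 := by
  funext v
  exact (Finset.sum_eq_zero_iff_of_nonneg (fun i _ => hE i)).1 h v (Finset.mem_univ v)

theorem eff_succ (E : Fin 6 → ℤ) (hE : Effective E) (h : 0 < degSum E) :
    ∃ v, Effective (E - Pi.single v 1) := by
  obtain ⟨v, -, hv⟩ := Finset.exists_lt_of_sum_lt
    (s := Finset.univ) (f := fun _ : Fin 6 => (0 : ℤ)) (g := E) (by simpa [degSum] using h)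
  refine ⟨v, fun w => ?_⟩
  by_cases hw : w = v
  · subst hw; simp; omega
  · simpa [hw] using hE w

theorem eff_one (E : Fin 6 → ℤ) (hE : Effective E) (h : degSum E = 1) :
    ∃ v, E = Pi.single v 1 := by
  obtain ⟨v, hv⟩ := eff_succ E hE (by omega)
  refine ⟨v, sub_eq_zero.1 (eff_zero _ hv ?_)⟩
  rw [degSum_sub, degSum_single, h]; rfl

theorem eff_two (E : Fin 6 → ℤ) (hE : Effective E) (h : degSum E = 2) :
    ∃ v w, E = Pi.single v 1 + Pi.single w 1 := by
  obtain ⟨v, hv⟩ := eff_succ E hE (by omega)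
  obtain ⟨w, hw⟩ := eff_one _ hv (by rw [degSum_sub, degSum_single, h]; rfl)
  exact ⟨v, w, by rw [← hw]; abel⟩

/-- If the rank is one then removing any vertex leaves a winnable divisor. -/
theorem rank_one (G : SimpleGraph (Fin 6)) (hdeg : ∀ D ∈ Principal G, degSum D = 0)
    (D : Fin 6 → ℤ) (h : bnRank G D = 1) (v : Fin 6) : Winnable G (D - Pi.single v 1) := by
  have hm : bnRank G D ∈ {r : ℤ | r = -1 ∨ (0 ≤ r ∧
    ∀ E : Fin 6 → ℤ, Effective E → degSum E = r → Winnable G (D - E))} := by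
    refine Int.csSup_mem ⟨-1, Or.inl rfl⟩ ⟨max (-1) (degSum D), ?_⟩
    rintro r (rfl | ⟨hr, hE⟩)
    · exact le_max_left _ _
    · obtain ⟨F, hF, hl⟩ := hE (Pi.single 0 r) (effective_single _ _ hr) (degSum_single _ _)
      have h1 := hdeg _ hl
      rw [degSum_sub, degSum_sub, degSum_single] at h1
      have h2 : 0 ≤ degSum F := Finset.sum_nonneg fun i _ => hF i
      exact le_max_of_le_right (by omega)
  rw [h] at hm
  rcases hm with hm | ⟨-, hm⟩
  · norm_num at hm
  · exact hm _ (effective_single _ _ (by norm_num)) (degSum_single _ _)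

/-- A divisor of degree two and rank one is equivalent to a sum through every vertex. -/
theorem rank_one_two (G : SimpleGraph (Fin 6)) (hdeg : ∀ D ∈ Principal G, degSum D = 0)
    (D : Fin 6 → ℤ) (h2 : degSum D = 2) (h : bnRank G D = 1) (v : Fin 6) :
    ∃ w, LinEquiv G D (Pi.single v 1 + Pi.single w 1) := by
  obtain ⟨F, hF, hl⟩ := rank_one G hdeg D h v
  have h1 := hdeg _ hl
  rw [degSum_sub, degSum_sub, degSum_single] at h1
  obtain ⟨w, rfl⟩ := eff_one F hF (by omega)
  refine ⟨w, ?_⟩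
  unfold LinEquiv at hl ⊢
  rwa [← sub_sub]

theorem num2 : numClasses (mkG E2) 2 1 = 0 := by
  have : {c : Pic (mkG E2) | ∃ D : Fin 6 → ℤ,
    QuotientAddGroup.mk' (Principal (mkG E2)) D = c ∧ degSum D = 2 ∧ bnRank (mkG E2) D = 1} =
      ∅ := by
    rw [Set.eq_empty_iff_forall_notMem]
    rintro _ ⟨D, -, h2, h⟩
    have key := rank_one_two (mkG E2) (fun D hD => ((principal2 D).1 hD).1) D h2 h
    have key' : ∀ v, ∃ w, phi c2 D = ((c2 v * 1 : ℤ) : ZMod 24) + ((c2 w * 1 : ℤ) : ZMod 24) := by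
      intro v
      obtain ⟨w, hw⟩ := key v
      refine ⟨w, ?_⟩
      have := ((principal2 _).1 hw).2
      rwa [map_sub, map_add, phi_single, phi_single, sub_eq_zero] at this
    revert key'
    generalize phi c2 D = z
    revert z
    decide +kernel
  rw [numClasses, this, Set.ncard_empty]

theorem rank1 : bnRank (mkG E1) (Pi.single 2 2) = 1 := by
  refine IsGreatest.csSup_eq ⟨Or.inr ⟨by norm_num, ?_⟩, ?_⟩
  · intro E hE h1
    obtain ⟨v, rfl⟩ := eff_one E hE h1
    have hw : ∀ v, ∃ w, ((c1 2 * 2 : ℤ) : ZMod 24) - ((c1 v * 1 : ℤ) : ZMod 24) -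
        ((c1 w * 1 : ℤ) : ZMod 24) = 0 := by decide +kernel
    obtain ⟨w, hw⟩ := hw v
    refine ⟨Pi.single w 1, effective_single _ _ (by norm_num), ?_⟩
    unfold LinEquiv
    rw [principal1]
    constructor
    · simp only [degSum_sub, degSum_single]; norm_num
    · rw [map_sub, map_sub, phi_single, phi_single, phi_single, hw]
  · rintro r (rfl | ⟨hr, hE⟩)
    · norm_num
    · by_contra hlt
      obtain ⟨F, hF, hl⟩ := hE (Pi.single 0 1 + Pi.single 2 (r - 1)) (by
          intro v
          exact add_nonneg (effective_single 0 1 (by norm_num) v)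
            (effective_single 2 (r - 1) (by omega) v)) (by
          rw [degSum_add, degSum_single, degSum_single]; ring)
      obtain ⟨h1, h2⟩ := (principal1 _).1 hl
      rw [degSum_sub, degSum_sub, degSum_add, degSum_single, degSum_single, degSum_single] at h1
      have h3 : 0 ≤ degSum F := Finset.sum_nonneg fun i _ => hF i
      obtain rfl : r = 2 := by omega
      obtain rfl := eff_zero F hF (by omega)
      rw [map_sub, map_sub, map_add, phi_single, phi_single, phi_single, map_zero] at h2
      revert h2
      decide +kernel

theorem num1 : numClasses (mkG E1) 2 1 ≠ 0 := by
  have hfin : {c : Pic (mkG E1) | ∃ D : Fin 6 → ℤ,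
    QuotientAddGroup.mk' (Principal (mkG E1)) D = c ∧ degSum D = 2 ∧
      bnRank (mkG E1) D = 1}.Finite := by
    refine (Set.finite_range (fun w : Fin 6 =>
      QuotientAddGroup.mk' (Principal (mkG E1)) (Pi.single 0 1 + Pi.single w 1))).subset ?_
    rintro _ ⟨D, rfl, h2, h⟩
    obtain ⟨w, hw⟩ := rank_one_two (mkG E1) (fun D hD => ((principal1 D).1 hD).1) D h2 h 0
    refine ⟨w, ?_⟩
    rw [eq_comm, ← sub_eq_zero, ← map_sub]
    exact (QuotientAddGroup.eq_zero_iff _).2 hw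
  refine ((Set.ncard_pos hfin).2 ?_).ne'
  exact ⟨_, Pi.single 2 2, rfl, degSum_single _ _, rank1⟩

/-- There are connected simple graphs with the same number of vertices and edges,
equal Tutte polynomials and isomorphic Jacobians, whose two-variable zeta functions
differ: for some degree `d` and rank `r` they have different numbers of divisor
classes of degree `d` and Baker–Norine rank `r`. -/
theorem exists_sameTutte_isoJac_differentZeta :
    ∃ (n : ℕ) (G G' : SimpleGraph (Fin n)),
      G.Connected ∧ G'.Connected ∧
      edgeCount G = edgeCount G' ∧
      tutte G = tutte G' ∧
      Nonempty (Jac G ≃+ Jac G') ∧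
      ∃ d r : ℤ, numClasses G d r ≠ numClasses G' d r := by
  refine ⟨6, mkG E1, mkG E2, conn1, conn2, ?_, tutte_eq, jac_iso, 2, 1, ?_⟩
  · rw [edgeCount_mkG E1 E1_ne E1_inj, edgeCount_mkG E2 E2_ne E2_inj]
  · rw [num2]
    exact num1

end BNGraph
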